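/- arXiv:0911.3919 — 2 statements merged into one kernel-verified Lean document; each statement's English description precedes it below -/
import Mathlib

section
/- (Meinrenken) The space V is the disjoint union of the sets (1 − w)(D°) := {x − w x : x ∈ D°} over w ∈ W: these sets cover V and are pairwise disjoint for distinct w ∈ W. -/
open scoped RealInnerProductSpace

noncomputable section

/-- `g` is the orthogonal reflection in the affine hyperplane `{x | ⟪x, u⟫ = c}`. -/
def IsAffRefl {V : Type*} [NormedAddCommGroup V] [InnerProductSpace ℝ V]
    (g : V ≃ᵢ V) : Prop :=
  ∃ (u : V) (c : ℝ), u ≠ 0 ∧ ∀ x : V, g x = x - ((2 * (⟪x, u⟫ - c)) / ⟪u, u⟫) • u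

/-- The union of the reflection hyperplanes (mirrors) of the reflections belonging to `W`;
the mirror of a reflection is exactly its set of fixed points. -/
def affMirrors {V : Type*} [NormedAddCommGroup V] [InnerProductSpace ℝ V]
    (W : Subgroup (V ≃ᵢ V)) : Set V :=
  ⋃ g ∈ {g : V ≃ᵢ V | g ∈ W ∧ IsAffRefl g}, {x : V | g x = x}


section helpers

variable {V : Type*} [NormedAddCommGroup V] [InnerProductSpace ℝ V]

lemma mk_lin (g : V ≃ᵢ V) : ∃ L : V ≃ₗᵢ[ℝ] V, ∀ y z, g y - g z = L (y - z) := by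
  refine ⟨g.toRealAffineIsometryEquiv.linearIsometryEquiv, fun y z => ?_⟩
  have := g.toRealAffineIsometryEquiv.map_vsub y z
  simpa using this.symm

lemma mk_refl_ne_one {g : V ≃ᵢ V} (hg : IsAffRefl g) : g ≠ 1 := by
  rintro rfl
  obtain ⟨u, c, hu, h⟩ := hg
  have huu : ⟪u, u⟫ ≠ 0 := by simpa using hu
  have h1 := h (((c + 1) / ⟪u, u⟫) • u)
  rw [real_inner_smul_left, div_mul_cancel₀ _ huu] at h1
  have h2 : ((2 * (c + 1 - c)) / ⟪u, u⟫) • u = 0 := by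
    have : (1 : V ≃ᵢ V) (((c + 1) / ⟪u, u⟫) • u) = ((c + 1) / ⟪u, u⟫) • u := rfl
    rw [this] at h1
    exact (sub_eq_self.mp h1.symm)
  rcases smul_eq_zero.mp h2 with h3 | h3
  · rw [div_eq_zero_iff] at h3
    rcases h3 with h3 | h3
    · norm_num at h3
    · exact huu h3
  · exact hu h3

lemma mk_closer {g : V ≃ᵢ V} (hg : IsAffRefl g) {p y z : V} (hz : z ∈ segment ℝ y p)
    (hgz : g z = z) (hp : g p ≠ p) (hy : g y ≠ y) : dist (g p) y < dist p y := by
  obtain ⟨u, c, hu, h⟩ := hg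
  have huu : 0 < ⟪u, u⟫ := by
    rw [real_inner_self_eq_norm_sq]; positivity
  have hfix : ∀ x, g x = x ↔ ⟪x, u⟫ - c = 0 := by
    intro x
    rw [h x, sub_eq_self, smul_eq_zero, div_eq_zero_iff]
    constructor
    · rintro ((h1 | h1) | h1)
      · linarith
      · exact absurd h1 huu.ne'
      · exact absurd h1 hu
    · intro h1; left; left; rw [h1]; ring
  have hp' := mt (hfix p).2 hp
  have hy' := mt (hfix y).2 hy
  have hz' := (hfix z).1 hgz
  obtain ⟨a, b, ha, hb, hab, rfl⟩ := hz
  rw [inner_add_left, real_inner_smul_left, real_inner_smul_left] at hz'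
  have hz2 : a * (⟪y, u⟫ - c) + b * (⟪p, u⟫ - c) = 0 := by
    have : c = (a + b) * c := by rw [hab, one_mul]
    linarith
  set s := ⟪y, u⟫ - c with hs
  set t := ⟪p, u⟫ - c with ht
  have hst : t * s < 0 := by
    have hbne : b ≠ 0 := by
      rintro rfl
      have : a = 1 := by linarith
      subst this
      apply hy'; linarith
    have hbpos : 0 < b := lt_of_le_of_ne hb hbne.symm
    have hane : a ≠ 0 := by
      rintro rfl
      have : b = 1 := by linarith
      subst this
      apply hp'; linarith
    have hapos : 0 < a := lt_of_le_of_ne ha hane.symm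
    have h1 : b * (t * s) = - (a * s ^ 2) := by
      have : b * t = - (a * s) := by linarith
      calc b * (t * s) = (b * t) * s := by ring
        _ = _ := by rw [this]; ring
    have : 0 < a * s ^ 2 := by positivity
    by_contra hcon
    push Not at hcon
    have := mul_nonneg hb hcon
    linarith
  rw [dist_eq_norm, dist_eq_norm]
  apply lt_of_pow_lt_pow_left₀ 2 (norm_nonneg _)
  have e : g p - y = (p - y) - ((2 * t) / ⟪u, u⟫) • u := by rw [h p]; abel
  rw [e, norm_sub_sq_real, norm_smul, mul_pow, real_inner_smul_right, inner_sub_left,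
    ← real_inner_self_eq_norm_sq u, Real.norm_eq_abs, sq_abs]
  have e2 : ⟪p, u⟫ - ⟪y, u⟫ = t - s := by rw [ht, hs]; ring
  rw [e2]
  have : (2 * t / ⟪u, u⟫) ^ 2 * ⟪u, u⟫ - 2 * (2 * t / ⟪u, u⟫ * (t - s)) = 4 * (t * s) / ⟪u, u⟫ := by
    field_simp; ring
  have h3 : 4 * (t * s) / ⟪u, u⟫ < 0 := div_neg_of_neg_of_pos (by linarith) huu
  linarith

lemma mk_mem_mirrors {W : Subgroup (V ≃ᵢ V)} {x : V} :
    x ∈ affMirrors W ↔ ∃ g ∈ W, IsAffRefl g ∧ g x = x := by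
  simp [affMirrors, and_assoc]

lemma mk_strict [FiniteDimensional ℝ V] (W : Subgroup (V ≃ᵢ V)) (C : Set V)
    (hpd : ∀ K : Set V, IsCompact K → {g : V ≃ᵢ V | g ∈ W ∧ ∃ x ∈ K, g x ∈ K}.Finite)
    (hCM : ∀ x ∈ C, x ∉ affMirrors W)
    (hseg : ∀ y ∈ C, ∀ p, (∀ z ∈ segment ℝ y p, z ∉ affMirrors W) → p ∈ C)
    (hdisj : ∀ w ∈ W, ∀ x ∈ C, w x ∈ C → w = 1)
    {x y : V} (hx : x ∈ C) (hy : y ∈ C) {g : V ≃ᵢ V} (hg : g ∈ W) (hg1 : g ≠ 1) :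
    dist x y < dist (g x) y := by
  have claim : ∀ g ∈ W, (∀ h ∈ W, dist (g x) y ≤ dist (h x) y) → g = 1 := by
    intro g hg hmin
    have hgM : g x ∉ affMirrors W := by
      intro hm
      obtain ⟨r, hr, hrr, hrx⟩ := mk_mem_mirrors.1 hm
      have h1 : (g⁻¹ * r * g) x = x := by
        show g⁻¹ (r (g x)) = x
        rw [hrx]; exact g.symm_apply_apply x
      have h2 := hdisj _ (W.mul_mem (W.mul_mem (W.inv_mem hg) hr) hg) x hx (by rw [h1]; exact hx)
      apply mk_refl_ne_one hrr
      have h3 : r = g * (g⁻¹ * r * g) * g⁻¹ := by group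
      rw [h3, h2]; group
    apply hdisj g hg x hx
    apply hseg y hy
    intro z hz hzM
    obtain ⟨r, hr, hrr, hrz⟩ := mk_mem_mirrors.1 hzM
    have := mk_closer hrr hz hrz (fun h => hgM (mk_mem_mirrors.2 ⟨r, hr, hrr, h⟩))
      (fun h => hCM y hy (mk_mem_mirrors.2 ⟨r, hr, hrr, h⟩))
    exact absurd (hmin (r * g) (W.mul_mem hr hg)) (not_le.2 this)
  have hfin : {g : V ≃ᵢ V | g ∈ W ∧ dist (g x) y ≤ dist x y}.Finite := by
    apply (hpd (Metric.closedBall y (dist x y)) (isCompact_closedBall _ _)).subset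
    rintro g ⟨hg, h⟩
    exact ⟨hg, x, by simp, by simpa using h⟩
  obtain ⟨g0, ⟨hg0, hg0'⟩, hmin⟩ := hfin.exists_minimalFor (fun g => dist (g x) y) _
    ⟨1, W.one_mem, le_refl _⟩
  have hmin' : ∀ h ∈ W, dist (g0 x) y ≤ dist (h x) y := by
    intro h hh
    by_contra hcon
    push Not at hcon
    have := hmin ⟨hh, hcon.le.trans hg0'⟩ hcon.le
    exact absurd hcon (not_lt.2 this)
  have h1 := claim g0 hg0 hmin'
  subst h1
  by_contra hcon
  push Not at hcon
  apply hg1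
  apply claim g hg
  intro h hh
  exact hcon.trans (hmin' h hh)

end helpers

section helpers2

open Filter Topology

variable {V : Type*} [NormedAddCommGroup V] [InnerProductSpace ℝ V]

lemma mk_core [FiniteDimensional ℝ V] (A : V ≃ₗᵢ[ℝ] V) (c : V) (hc : c ≠ 0) (t : ℕ → ℝ) (p : ℕ → V)
    (ht0 : ∀ n, 0 < t n) (ht1 : ∀ n, t n < 1) (ht : Tendsto t atTop (𝓝 0))
    (hp : Tendsto p atTop (𝓝 0)) (heq : ∀ n, p n = t n • c + (1 - t n) • A (p n))
    (hpos : ∀ n, 0 ≤ ⟪A (p n), c⟫) : False := by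
  have horth : ∀ v, A v = v → ⟪c, v⟫ = 0 := by
    intro v hv
    have h1 : ∀ n, ⟪p n, v⟫ = ⟪c, v⟫ := by
      intro n
      have h2 : ⟪A (p n), v⟫ = ⟪p n, v⟫ := by
        conv_lhs => rw [← hv]
        exact A.inner_map_map _ _
      have h3 : ⟪p n, v⟫ = t n * ⟪c, v⟫ + (1 - t n) * ⟪p n, v⟫ := by
        conv_lhs => rw [heq n]
        rw [inner_add_left, real_inner_smul_left, real_inner_smul_left, h2]
      have h4 : t n * (⟪p n, v⟫ - ⟪c, v⟫) = 0 := by linarith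
      rcases mul_eq_zero.1 h4 with h | h
      · exact absurd h (ht0 n).ne'
      · linarith
    have h5 : Tendsto (fun n => ⟪p n, v⟫) atTop (𝓝 ⟪(0 : V), v⟫) := hp.inner tendsto_const_nhds
    simp only [h1, inner_zero_left] at h5
    exact tendsto_nhds_unique tendsto_const_nhds h5
  let T : V →ₗ[ℝ] V := LinearMap.id - A.toLinearEquiv.toLinearMap
  have hT : ∀ y, T y = y - A y := fun y => rfl
  have hcr : c ∈ LinearMap.range T := by
    rw [← Submodule.orthogonal_orthogonal (LinearMap.range T), Submodule.mem_orthogonal]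
    intro v hv
    rw [real_inner_comm]
    apply horth
    have h1 : ⟪v - A v, v⟫ = 0 := by
      have := (Submodule.mem_orthogonal _ _).1 hv (T v) ⟨v, rfl⟩
      rwa [hT] at this
    have h2 : ‖v - A v‖ ^ 2 = 0 := by
      rw [norm_sub_sq_real, A.norm_map]
      rw [inner_sub_left, real_inner_self_eq_norm_sq, real_inner_comm] at h1
      linarith
    have h3 : v - A v = 0 := by simpa using h2
    exact (sub_eq_zero.1 h3).symm
  obtain ⟨y, hy⟩ := hcr
  rw [hT] at hy
  have hbound : ∀ n, ‖p n‖ ≤ 2 * t n * ‖y‖ := by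
    intro n
    have h0 := ht0 n
    have h1 := ht1 n
    set r := p n - t n • y with hr
    have hpr : p n = r + t n • y := by rw [hr]; abel
    have e : r = (1 - t n) • A r - (t n) ^ 2 • A y := by
      have := heq n
      rw [← hy, hpr, map_add, map_smul] at this
      have e2 : r = t n • (y - A y) + (1 - t n) • (A r + t n • A y) - t n • y := by
        rw [← this]; abel
      have e3 : t n • (y - A y) + (1 - t n) • (A r + t n • A y) - t n • y
        = (1 - t n) • A r - (t n) ^ 2 • A y := by
        module
      exact e2.trans e3
    have hn : ‖r‖ ≤ (1 - t n) * ‖r‖ + (t n) ^ 2 * ‖y‖ := by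
      calc ‖r‖ = ‖(1 - t n) • A r - (t n) ^ 2 • A y‖ := by rw [← e]
        _ ≤ ‖(1 - t n) • A r‖ + ‖(t n) ^ 2 • A y‖ := norm_sub_le _ _
        _ = _ := by
          rw [norm_smul, norm_smul, A.norm_map, A.norm_map, Real.norm_of_nonneg (by linarith),
            Real.norm_of_nonneg (by positivity)]
    have hn2 : ‖r‖ ≤ t n * ‖y‖ := by
      have : t n * ‖r‖ ≤ t n * (t n * ‖y‖) := by nlinarith
      exact le_of_mul_le_mul_left this h0
    calc ‖p n‖ = ‖r + t n • y‖ := by rw [← hpr]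
      _ ≤ ‖r‖ + ‖t n • y‖ := norm_add_le _ _
      _ = ‖r‖ + t n * ‖y‖ := by rw [norm_smul, Real.norm_of_nonneg h0.le]
      _ ≤ _ := by linarith
  have hfin : ∀ n, ‖c‖ ^ 2 ≤ 8 * ‖y‖ ^ 2 * t n := by
    intro n
    have h0 := ht0 n
    have h1 := ht1 n
    have h2 : ‖p n‖ ^ 2 = (t n) ^ 2 * ‖c‖ ^ 2 + 2 * (t n * (1 - t n) * ⟪A (p n), c⟫)
        + (1 - t n) ^ 2 * ‖p n‖ ^ 2 := by
      conv_lhs => rw [heq n]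
      rw [norm_add_sq_real, norm_smul, norm_smul, A.norm_map, real_inner_smul_left,
        real_inner_smul_right, mul_pow, mul_pow, Real.norm_eq_abs, Real.norm_eq_abs, sq_abs, sq_abs,
        real_inner_comm]
      ring
    have h3 : 0 ≤ t n * (1 - t n) * ⟪A (p n), c⟫ :=
      mul_nonneg (mul_nonneg h0.le (by linarith)) (hpos n)
    have h4 : ‖p n‖ ^ 2 ≤ (2 * t n * ‖y‖) ^ 2 := by
      gcongr; exact hbound n
    have h5 : (t n) ^ 2 * ‖c‖ ^ 2 ≤ 2 * t n * ‖p n‖ ^ 2 := by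
      have : 0 ≤ (t n) ^ 2 * ‖p n‖ ^ 2 := by positivity
      nlinarith
    have h6 : (t n) ^ 2 * ‖c‖ ^ 2 ≤ (t n) ^ 2 * (8 * ‖y‖ ^ 2 * t n) := by
      calc _ ≤ 2 * t n * ‖p n‖ ^ 2 := h5
        _ ≤ 2 * t n * (2 * t n * ‖y‖) ^ 2 := by gcongr
        _ = _ := by ring
    exact le_of_mul_le_mul_left h6 (by positivity)
  have h7 : Tendsto (fun n => 8 * ‖y‖ ^ 2 * t n) atTop (𝓝 (8 * ‖y‖ ^ 2 * 0)) := ht.const_mul _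
  have h8 := ge_of_tendsto' h7 hfin
  have : 0 < ‖c‖ ^ 2 := by positivity
  linarith

lemma mk_sep (S : Set (V ≃ᵢ V)) (hS : S.Finite) (x y : V) :
    ∃ δ > 0, ∀ g ∈ S, g x ≠ y → 2 * δ ≤ dist (g x) y := by
  induction S, hS using Set.Finite.induction_on with
  | empty => exact ⟨1, one_pos, by simp⟩
  | @insert a s _ _ ih =>
    obtain ⟨δ, hδ, h⟩ := ih
    by_cases hax : a x = y
    · refine ⟨δ, hδ, ?_⟩
      rintro g (rfl | hg) hne
      · exact absurd hax hne
      · exact h g hg hne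
    · have hpos : 0 < dist (a x) y := dist_pos.2 hax
      refine ⟨min δ (dist (a x) y / 2), lt_min hδ (by positivity), ?_⟩
      rintro g (rfl | hg) hne
      · have := min_le_right δ (dist (g x) y / 2); linarith
      · have := min_le_left δ (dist (a x) y / 2); have := h g hg hne; linarith

lemma mk_loc [FiniteDimensional ℝ V] (W : Subgroup (V ≃ᵢ V))
    (hpd : ∀ K : Set V, IsCompact K → {g : V ≃ᵢ V | g ∈ W ∧ ∃ x ∈ K, g x ∈ K}.Finite) (x : V) :
    ∃ δ > 0, ∀ g ∈ W, ∀ z, dist z x < δ → g z = z → g x = x := by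
  obtain ⟨δ, hδ, h⟩ := mk_sep _ (hpd (Metric.closedBall x 1) (isCompact_closedBall _ _)) x x
  refine ⟨min δ 1, lt_min hδ one_pos, fun g hg z hz hgz => ?_⟩
  by_contra hne
  have hz1 := hz.trans_le (min_le_right _ _)
  have hz2 := hz.trans_le (min_le_left _ _)
  have hzb : z ∈ Metric.closedBall x 1 := by simpa using hz1.le
  have h1 := h g ⟨hg, z, hzb, by rwa [hgz]⟩ hne
  have h2 : dist (g x) x ≤ dist (g x) (g z) + dist (g z) x := dist_triangle _ _ _
  rw [g.dist_eq, hgz, dist_comm x z] at h2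
  linarith

lemma mk_c [FiniteDimensional ℝ V] (W : Subgroup (V ≃ᵢ V)) (C D : Set V)
    (hpd : ∀ K : Set V, IsCompact K → {g : V ≃ᵢ V | g ∈ W ∧ ∃ x ∈ K, g x ∈ K}.Finite)
    (hCM : ∀ x ∈ C, x ∉ affMirrors W)
    (hseg : ∀ y ∈ C, ∀ p, (∀ z ∈ segment ℝ y p, z ∉ affMirrors W) → p ∈ C)
    (hCD : C ⊆ D) (hCne : C.Nonempty)
    (hCseg : ∀ y ∈ C, ∀ x ∈ D, ∀ t : ℝ, 0 < t → t ≤ 1 → x + t • (y - x) ∈ C)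
    (hle : ∀ p ∈ D, ∀ q ∈ D, ∀ g ∈ W, dist p q ≤ dist p (g q))
    (x : V) (hx : x ∈ D) (hxM : x ∈ affMirrors W) (δ : ℝ) (hδ : 0 < δ) :
    ∃ c ∈ D, c ≠ x ∧ dist c x < δ ∧ (∀ q ∈ D, 0 ≤ ⟪q - x, c - x⟫) ∧
      (∀ y, (∀ g ∈ W, g x = x → g y = y) → ⟪c - x, y - x⟫ = 0) := by
  classical
  let H : Subgroup (V ≃ᵢ V) :=
    { carrier := {g | g ∈ W ∧ g x = x}
      mul_mem' := by
        rintro a b ⟨ha, ha'⟩ ⟨hb, hb'⟩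
        refine ⟨W.mul_mem ha hb, ?_⟩
        show a (b x) = x
        rw [hb', ha']
      one_mem' := ⟨W.one_mem, rfl⟩
      inv_mem' := by
        rintro a ⟨ha, ha'⟩
        refine ⟨W.inv_mem ha, ?_⟩
        show a.symm x = x
        rw [IsometryEquiv.symm_apply_eq, ha'] }
  have hHfin : (H : Set (V ≃ᵢ V)).Finite := by
    apply (hpd {x} isCompact_singleton).subset
    rintro g ⟨hg, hgx⟩
    exact ⟨hg, x, rfl, hgx⟩
  have : Finite H := hHfin
  have : Fintype H := Fintype.ofFinite H
  have hHx : ∀ g : H, g.1 x = x := fun g => g.2.2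
  have hN : (0 : ℝ) < Fintype.card H := by exact_mod_cast Fintype.card_pos
  set N : ℝ := ((Fintype.card H : ℕ) : ℝ) with hNdef
  choose L hL using fun g : V ≃ᵢ V => mk_lin g
  obtain ⟨c0, hc0⟩ := hCne
  -- the averaged vector
  set m : V := N⁻¹ • ∑ h : H, (h.1 c0 - x) with hm
  have hLm : ∀ g : H, L g.1 m = m := by
    intro g
    rw [hm, map_smul, map_sum]
    congr 1
    apply Fintype.sum_equiv (Equiv.mulLeft g)
    intro h
    rw [← hL, hHx]
    rfl
  have hmfix : ∀ (g : H) (s : ℝ) (z : V), g.1 (z + s • m) = g.1 z + s • m := by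
    intro g s z
    have := hL g.1 (z + s • m) z
    rw [add_sub_cancel_left, map_smul, hLm] at this
    exact sub_eq_iff_eq_add'.1 this
  set e : V := (c0 - x) - m with he
  obtain ⟨δ1, hδ1, hloc⟩ := mk_loc W hpd x
  -- e is nonzero
  have hene : e ≠ 0 := by
    intro he0
    obtain ⟨r, hr, hrr, hrx⟩ := mk_mem_mirrors.1 hxM
    have h1 : c0 = x + (1 : ℝ) • m := by
      rw [one_smul, ← sub_eq_zero, ← he0, he]; abel
    have h2 := hmfix ⟨r, hr, hrx⟩ 1 x
    rw [← h1] at h2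
    simp only [hrx] at h2
    rw [← h1] at h2
    exact hCM c0 hc0 (mk_mem_mirrors.2 ⟨r, hr, hrr, h2⟩)
  set B : ℝ := ‖c0 - x‖ + ‖m‖ with hB
  have hB0 : 0 ≤ B := by positivity
  obtain ⟨ε, hε0, hε1, hεB⟩ : ∃ ε : ℝ, 0 < ε ∧ ε ≤ 1 ∧ ε * B < min δ δ1 := by
    have hmin : 0 < min δ δ1 := lt_min hδ hδ1
    refine ⟨min 1 (min δ δ1 / (B + 1)), lt_min one_pos (by positivity), min_le_left _ _, ?_⟩
    calc _ ≤ (min δ δ1 / (B + 1)) * B := by gcongr; exact min_le_right _ _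
      _ < _ := by
        rw [div_mul_eq_mul_div, div_lt_iff₀ (by positivity)]
        nlinarith
  have hεδ := hεB.trans_le (min_le_left _ _)
  have hεδ1 := hεB.trans_le (min_le_right _ _)
  set c : V := x + ε • e with hc
  have hcx : c - x = ε • e := by rw [hc]; abel
  have hbd : ∀ s : ℝ, 0 ≤ s → s ≤ 1 → ‖ε • ((c0 - x) - s • m)‖ ≤ ε * B := by
    intro s hs0 hs1
    rw [norm_smul, Real.norm_of_nonneg hε0.le]
    gcongr
    calc _ ≤ ‖c0 - x‖ + ‖s • m‖ := norm_sub_le _ _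
      _ ≤ _ := by
        rw [norm_smul, Real.norm_of_nonneg hs0, hB]
        nlinarith [norm_nonneg m]
  have hcC : c ∈ C := by
    apply hseg _ (hCseg c0 hc0 x hx ε hε0 hε1)
    intro z hz hzM
    obtain ⟨a, b, ha, hb, hab, hz⟩ := hz
    have hz' : z = x + ε • ((c0 - x) - b • m) := by
      rw [← hz, hc, he]
      have : a = 1 - b := by linarith
      subst this
      module
    have hzx : dist z x < δ1 := by
      rw [dist_eq_norm, hz', add_sub_cancel_left]
      exact (hbd b hb (by linarith)).trans_lt hεδ1
    obtain ⟨r, hr, hrr, hrz⟩ := mk_mem_mirrors.1 hzM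
    have hrx := hloc r hr z hzx hrz
    have h1 := hmfix ⟨r, hr, hrx⟩ (ε * b) z
    have h2 : z + (ε * b) • m = x + ε • (c0 - x) := by rw [hz']; module
    simp only [hrz] at h1
    rw [h2] at h1
    exact hCM _ (hCseg c0 hc0 x hx ε hε0 hε1) (mk_mem_mirrors.2 ⟨r, hr, hrr, h1⟩)
  have hLc : ∀ g : H, g.1 c - x = L g.1 (c - x) := by
    intro g; rw [← hL, hHx]
  have hsum : ∑ g : H, (g.1 c - x) = 0 := by
    have h1 : ∀ g : H, g.1 c - x = ε • ((g.1 c0 - x) - m) := by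
      intro g
      rw [hLc, hcx, map_smul, he, map_sub, hLm, ← hL, hHx]
    simp only [h1]
    rw [← Finset.smul_sum, Finset.sum_sub_distrib, Finset.sum_const, Finset.card_univ,
      ← Nat.cast_smul_eq_nsmul ℝ, ← hNdef, hm, smul_smul, mul_inv_cancel₀ hN.ne', one_smul,
      sub_self, smul_zero]
  have hnorm : ∀ g : H, ‖g.1 c - x‖ = ‖c - x‖ := by
    intro g; rw [hLc, LinearIsometryEquiv.norm_map]
  refine ⟨c, hCD hcC, ?_, ?_, ?_, ?_⟩
  · rw [← sub_ne_zero, hcx]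
    exact smul_ne_zero hε0.ne' hene
  · rw [dist_eq_norm, hcx, he]
    have := hbd 1 zero_le_one le_rfl
    rw [one_smul] at this
    exact this.trans_lt hεδ
  · intro q hq
    have h1 : ∀ g : H, ⟪q - x, g.1 c - x⟫ ≤ ⟪q - x, c - x⟫ := by
      intro g
      have h2 := hle q hq c (hCD hcC) g.1 g.2.1
      rw [dist_eq_norm, dist_eq_norm] at h2
      have h3 : ‖(q - x) - (c - x)‖ ^ 2 ≤ ‖(q - x) - (g.1 c - x)‖ ^ 2 := by
        rw [sub_sub_sub_cancel_right, sub_sub_sub_cancel_right]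
        gcongr
      rw [norm_sub_sq_real (q - x) (c - x), norm_sub_sq_real (q - x) (g.1 c - x), hnorm] at h3
      linarith
    have h4 := Finset.sum_le_sum (fun g (_ : g ∈ (Finset.univ : Finset H)) => h1 g)
    rw [← inner_sum, hsum, inner_zero_right, Finset.sum_const, Finset.card_univ,
      nsmul_eq_mul] at h4
    exact nonneg_of_mul_nonneg_right h4 hN
  · intro y hy
    have h1 : ∀ g : H, ⟪g.1 c - x, y - x⟫ = ⟪c - x, y - x⟫ := by
      intro g
      have : y - x = L g.1 (y - x) := by rw [← hL, hHx, hy g.1 g.2.1 g.2.2]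
      conv_lhs => rw [hLc, this]
      exact LinearIsometryEquiv.inner_map_map _ _ _
    have h2 : ∑ g : H, ⟪g.1 c - x, y - x⟫ = 0 := by
      rw [← sum_inner, hsum, inner_zero_left]
    simp only [h1] at h2
    rw [Finset.sum_const, Finset.card_univ, nsmul_eq_mul] at h2
    rcases mul_eq_zero.1 h2 with h | h
    · exact absurd h hN.ne'
    · exact h

end helpers2

section helpers3

open Filter Topology

variable {V : Type*} [NormedAddCommGroup V] [InnerProductSpace ℝ V]

lemma mk_approx [FiniteDimensional ℝ V] (D : Set V) (hconv : Convex ℝ D) (π : V → V)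
    (hπD : ∀ v, π v ∈ D) (hπ : ∀ a b, dist (π a) (π b) ≤ dist a b) (u c : V) (hc : c ∈ D)
    (t : ℝ) (ht0 : 0 < t) (ht1 : t < 1) :
    ∃ p ∈ D, p = t • c + (1 - t) • π (p - u) := by
  let f : V → V := fun p => t • c + (1 - t) • π (p - u)
  have hf : ContractingWith (Real.toNNReal (1 - t)) f := by
    refine ⟨?_, ?_⟩
    · rw [← NNReal.coe_lt_coe, Real.coe_toNNReal _ (by linarith), NNReal.coe_one]; linarith
    · apply LipschitzWith.of_dist_le_mul
      intro a b
      rw [Real.coe_toNNReal _ (by linarith)]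
      show dist (t • c + (1 - t) • π (a - u)) (t • c + (1 - t) • π (b - u)) ≤ (1 - t) * dist a b
      rw [dist_add_left, dist_smul₀, Real.norm_of_nonneg (by linarith)]
      have := hπ (a - u) (b - u)
      rw [dist_sub_right] at this
      have h1 : 0 ≤ 1 - t := by linarith
      gcongr
  have hcs : CompleteSpace V := FiniteDimensional.complete ℝ V
  have hfix : f (hf.fixedPoint f) = hf.fixedPoint f := hf.fixedPoint_isFixedPt
  refine ⟨hf.fixedPoint f, ?_, hfix.symm⟩
  rw [← hfix]
  exact hconv hc (hπD _) ht0.le (by linarith) (by ring)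

lemma mk_pigeon {α : Type*} (S : Set α) (hS : S.Finite) (w : ℕ → α) (hw : ∀ n, w n ∈ S) :
    ∃ g ∈ S, ∃ φ : ℕ → ℕ, StrictMono φ ∧ ∀ n, w (φ n) = g := by
  by_contra hcon
  have h1 : ∀ g ∈ S, ∀ᶠ n in atTop, w n ≠ g := by
    intro g hg
    by_contra h
    have h2 : ∃ᶠ n in atTop, w n = g := by
      simpa [Filter.Frequently] using h
    obtain ⟨φ, hφ, h3⟩ := extraction_of_frequently_atTop h2
    exact hcon ⟨g, hg, φ, hφ, h3⟩
  have h2 := (Filter.eventually_all_finite hS).2 h1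
  obtain ⟨n, hn⟩ := h2.exists
  exact hn _ (hw n) rfl

lemma mk_exist [FiniteDimensional ℝ V] (W : Subgroup (V ≃ᵢ V)) (C D : Set V)
    (hpd : ∀ K : Set V, IsCompact K → {g : V ≃ᵢ V | g ∈ W ∧ ∃ x ∈ K, g x ∈ K}.Finite)
    (hCM : ∀ x ∈ C, x ∉ affMirrors W)
    (hseg : ∀ y ∈ C, ∀ p, (∀ z ∈ segment ℝ y p, z ∉ affMirrors W) → p ∈ C)
    (hCD : C ⊆ D) (hCne : C.Nonempty)
    (hCseg : ∀ y ∈ C, ∀ x ∈ D, ∀ t : ℝ, 0 < t → t ≤ 1 → x + t • (y - x) ∈ C)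
    (hle : ∀ p ∈ D, ∀ q ∈ D, ∀ g ∈ W, dist p q ≤ dist p (g q))
    (hDcpt : IsCompact D) (hconv : Convex ℝ D)
    (hDC : ∀ x ∈ D, x ∉ affMirrors W → x ∈ C)
    (hcover : ∀ v : V, ∃ w ∈ W, ∃ x ∈ D, w x = v) (u : V) :
    ∃ w ∈ W, ∃ x ∈ C, u = x - w x := by
  choose ω hω π hπD hωπ using hcover
  have hπ : ∀ a b, dist (π a) (π b) ≤ dist a b := by
    intro a b
    have h1 := hle (π a) (hπD a) (π b) (hπD b) ((ω a)⁻¹ * ω b) (W.mul_mem (W.inv_mem (hω a)) (hω b))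
    refine h1.trans (le_of_eq ?_)
    rw [← (ω a).dist_eq, hωπ]
    congr 1
    show (ω a) ((ω a).symm ((ω b) (π b))) = b
    rw [IsometryEquiv.apply_symm_apply, hωπ]
  have hπfix : ∀ x ∈ D, ∀ w ∈ W, π (w x) = x := by
    intro x hx w hw
    have h1 := hle x hx (π (w x)) (hπD _) (w⁻¹ * ω (w x)) (W.mul_mem (W.inv_mem hw) (hω _))
    have h2 : (w⁻¹ * ω (w x)) (π (w x)) = x := by
      show w.symm ((ω (w x)) (π (w x))) = x
      rw [hωπ, IsometryEquiv.symm_apply_apply]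
    rw [h2, dist_self] at h1
    exact (dist_le_zero.1 h1).symm
  have hπc : Continuous π := by
    have : LipschitzWith 1 π := LipschitzWith.of_dist_le_mul (by simpa using hπ)
    exact this.continuous
  let t : ℕ → ℝ := fun n => 1 / ((n : ℝ) + 2)
  have ht0 : ∀ n, 0 < t n := fun n => by show 0 < 1 / ((n : ℝ) + 2); positivity
  have ht1 : ∀ n, t n < 1 := fun n => by
    show 1 / ((n : ℝ) + 2) < 1
    rw [div_lt_one (by positivity)]
    have : (0 : ℝ) ≤ n := Nat.cast_nonneg n
    linarith
  have ht : Tendsto t atTop (𝓝 0) := by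
    have h := tendsto_const_div_atTop_nhds_zero_nat (1 : ℝ)
    have h2 := (tendsto_add_atTop_iff_nat 2).2 h
    simpa [t] using h2
  -- limits of approximate fixed points are fixed points
  have hlim : ∀ c (p : ℕ → V) (s : ℕ → ℝ) (x : V), Tendsto s atTop (𝓝 0) → Tendsto p atTop (𝓝 x) →
      (∀ n, p n = s n • c + (1 - s n) • π (p n - u)) → π (x - u) = x := by
    intro c p s x hs hp heq
    have h1 : Tendsto (fun n => s n • c + (1 - s n) • π (p n - u)) atTop
        (𝓝 ((0 : ℝ) • c + (1 - 0 : ℝ) • π (x - u))) :=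
      (hs.smul_const c).add (((tendsto_const_nhds).sub hs).smul
        ((hπc.tendsto _).comp (hp.sub tendsto_const_nhds)))
    have h2 : (fun n => s n • c + (1 - s n) • π (p n - u)) = p := funext fun n => (heq n).symm
    rw [h2] at h1
    have := tendsto_nhds_unique h1 hp
    simpa using this
  let F : Set V := {x | x ∈ D ∧ π (x - u) = x}
  have hFne : F.Nonempty := by
    obtain ⟨c, hc⟩ := hCne
    choose p hpD hp using fun n => mk_approx D hconv π hπD hπ u c (hCD hc) (t n) (ht0 n) (ht1 n)
    obtain ⟨x, hx, φ, hφ, hpx⟩ := hDcpt.tendsto_subseq hpD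
    exact ⟨x, hx, hlim c (p ∘ φ) (t ∘ φ) x (ht.comp hφ.tendsto_atTop) hpx (fun n => hp (φ n))⟩
  let st : V → Set (V ≃ᵢ V) := fun x => {g | g ∈ W ∧ g x = x}
  have hstfin : ∀ x, (st x).Finite := by
    intro x
    apply (hpd {x} isCompact_singleton).subset
    rintro g ⟨hg, hgx⟩
    exact ⟨hg, x, rfl, hgx⟩
  obtain ⟨x, hxF, hxmin⟩ : ∃ x ∈ F, ∀ y ∈ F, (st x).ncard ≤ (st y).ncard := by
    have hne : ((fun x => (st x).ncard) '' F).Nonempty := hFne.image _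
    obtain ⟨x, hx, hx'⟩ := Nat.sInf_mem hne
    refine ⟨x, hx, fun y hy => ?_⟩
    have := Nat.sInf_le (Set.mem_image_of_mem (fun x => (st x).ncard) hy)
    simp only at hx'
    omega
  obtain ⟨hxD, hxfix⟩ := hxF
  by_cases hxM : x ∈ affMirrors W
  swap
  · refine ⟨ω (x - u), hω _, x, hDC x hxD hxM, ?_⟩
    have := hωπ (x - u)
    rw [hxfix] at this
    rw [this]; abel
  exfalso
  let K : Set V := D ∪ (fun y => y - u) '' D
  have hK : IsCompact K := hDcpt.union (hDcpt.image (by fun_prop))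
  obtain ⟨δ1, hδ1, hloc⟩ := mk_loc W hpd x
  obtain ⟨δ2, hδ2, hsep⟩ := mk_sep _ (hpd K hK) x (x - u)
  obtain ⟨c, hcD, hcx, hcδ, hpos, horth⟩ := mk_c W C D hpd hCM hseg hCD hCne hCseg hle x hxD hxM
    (min δ1 δ2) (lt_min hδ1 hδ2)
  have hcδ1 := hcδ.trans_le (min_le_left _ _)
  have hcδ2 := hcδ.trans_le (min_le_right _ _)
  choose p hpD hp using fun n => mk_approx D hconv π hπD hπ u c hcD (t n) (ht0 n) (ht1 n)
  have hpx : ∀ n, dist (p n) x ≤ dist c x := by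
    intro n
    have h1 : dist (π (p n - u)) x ≤ dist (p n) x := by
      have := hπ (p n - u) (x - u)
      rwa [hxfix, dist_sub_right] at this
    have h2 : p n - x = t n • (c - x) + (1 - t n) • (π (p n - u) - x) := by
      conv_lhs => rw [hp n]
      module
    have h0 := ht0 n
    have h01 := ht1 n
    have h3 : dist (p n) x ≤ t n * dist c x + (1 - t n) * dist (p n) x := by
      calc dist (p n) x = ‖t n • (c - x) + (1 - t n) • (π (p n - u) - x)‖ := by
            rw [dist_eq_norm, h2]
        _ ≤ ‖t n • (c - x)‖ + ‖(1 - t n) • (π (p n - u) - x)‖ := norm_add_le _ _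
        _ = t n * dist c x + (1 - t n) * dist (π (p n - u)) x := by
            rw [norm_smul, norm_smul, Real.norm_of_nonneg h0.le, Real.norm_of_nonneg (by linarith),
              dist_eq_norm, dist_eq_norm]
        _ ≤ _ := by
            have : 0 ≤ 1 - t n := by linarith
            gcongr
    have h4 : t n * dist (p n) x ≤ t n * dist c x := by linarith
    exact le_of_mul_le_mul_left h4 h0
  obtain ⟨x', hx'D, φ, hφ, hφx⟩ := hDcpt.tendsto_subseq hpD
  obtain ⟨w, hwS, ψ, hψ, hw⟩ := mk_pigeon _ (hpd K hK) (fun n => ω (p (φ n) - u))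
    (fun n => ⟨hω _, π (p (φ n) - u), Or.inl (hπD _), by
      rw [hωπ]; exact Or.inr ⟨p (φ n), hpD _, rfl⟩⟩)
  have hwW : w ∈ W := hwS.1
  set P : ℕ → V := fun n => p (φ (ψ n)) with hP
  set s : ℕ → ℝ := fun n => t (φ (ψ n)) with hs
  have hslim : Tendsto s atTop (𝓝 0) := ht.comp (hφ.comp hψ).tendsto_atTop
  have hPlim : Tendsto P atTop (𝓝 x') := hφx.comp hψ.tendsto_atTop
  have hPeq : ∀ n, P n = s n • c + (1 - s n) • π (P n - u) := fun n => hp _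
  have hwP : ∀ n, w (π (P n - u)) = P n - u := by
    intro n
    have := hωπ (P n - u)
    rwa [show ω (P n - u) = w from hw n] at this
  have hx'fix : π (x' - u) = x' := hlim c P s x' hslim hPlim hPeq
  have hwx' : w x' = x' - u := by
    have h1 : Tendsto (fun n => w (π (P n - u))) atTop (𝓝 (w (π (x' - u)))) :=
      (w.continuous.tendsto _).comp ((hπc.tendsto _).comp (hPlim.sub tendsto_const_nhds))
    simp only [hwP] at h1
    rw [hx'fix] at h1
    exact tendsto_nhds_unique h1 (hPlim.sub tendsto_const_nhds)
  have hx'x : dist x' x ≤ dist c x :=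
    le_of_tendsto (hPlim.dist tendsto_const_nhds) (Eventually.of_forall fun n => hpx _)
  have hwx : w x = x - u := by
    by_contra hne
    have h1 := hsep w hwS hne
    have h2 : dist (w x) (x - u) ≤ dist (w x) (w x') + dist (w x') (x - u) := dist_triangle _ _ _
    rw [w.dist_eq, hwx', dist_sub_right, dist_comm x x'] at h2
    linarith
  -- x' has the same stabilizer as x
  have hsub : st x' ⊆ st x := by
    rintro g ⟨hg, hgx⟩
    exact ⟨hg, hloc g hg x' (hx'x.trans_lt hcδ1) hgx⟩
  have hsteq : st x' = st x :=
    Set.eq_of_subset_of_ncard_le hsub (hxmin x' ⟨hx'D, hx'fix⟩) (hstfin x)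
  have hox' : ⟪c - x, x' - x⟫ = 0 := by
    apply horth
    intro g hg hgx
    have : g ∈ st x' := by rw [hsteq]; exact ⟨hg, hgx⟩
    exact this.2
  obtain ⟨A, hA⟩ := mk_lin w.symm
  have hsx : w.symm (x - u) = x := by rw [IsometryEquiv.symm_apply_eq, hwx]
  have hq : ∀ n, π (P n - u) - x = A (P n - x) := by
    intro n
    have h1 : w.symm (P n - u) = π (P n - u) := by rw [IsometryEquiv.symm_apply_eq, hwP]
    rw [← h1]
    conv_lhs => rw [← hsx]
    rw [hsx, ← hsx, hA, hsx]
    congr 1; abel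
  have hAx' : A (x' - x) = x' - x := by
    have h1 : w.symm (x' - u) = x' := by rw [IsometryEquiv.symm_apply_eq, hwx']
    have h2 := hA (x' - u) (x - u)
    rw [h1, hsx, sub_sub_sub_cancel_right] at h2
    exact h2.symm
  have hPx : ∀ n, P n - x = s n • (c - x) + (1 - s n) • A (P n - x) := by
    intro n
    rw [← hq]
    conv_lhs => rw [hPeq n]
    module
  have hx'eq : x' = x := by
    have h1 : ∀ n, ⟪P n - x, x' - x⟫ = 0 := by
      intro n
      have h2 : ⟪A (P n - x), x' - x⟫ = ⟪P n - x, x' - x⟫ := by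
        conv_lhs => rw [← hAx']
        exact A.inner_map_map _ _
      have h3 : ⟪P n - x, x' - x⟫ = (1 - s n) * ⟪P n - x, x' - x⟫ := by
        conv_lhs => rw [hPx n]
        rw [inner_add_left, real_inner_smul_left, real_inner_smul_left, h2, hox']
        ring
      have h4 : s n * ⟪P n - x, x' - x⟫ = 0 := by linarith
      rcases mul_eq_zero.1 h4 with h | h
      · exact absurd h (ht0 _).ne'
      · exact h
    have h5 : Tendsto (fun n => ⟪P n - x, x' - x⟫) atTop (𝓝 ⟪x' - x, x' - x⟫) :=
      (hPlim.sub tendsto_const_nhds).inner tendsto_const_nhds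
    simp only [h1] at h5
    have h6 := tendsto_nhds_unique h5 tendsto_const_nhds
    exact sub_eq_zero.1 (inner_self_eq_zero.1 h6)
  subst hx'eq
  refine mk_core A (c - x') (sub_ne_zero.2 hcx) s (fun n => P n - x') (fun n => ht0 _)
    (fun n => ht1 _) hslim ?_ hPx ?_
  · have := hPlim.sub (tendsto_const_nhds (x := x'))
    rwa [sub_self] at this
  · intro n
    rw [← hq]
    exact hpos _ (hπD _)

end helpers3

/-- Meinrenken's theorem: `V` is the disjoint union over `w ∈ W` of the sets
`(1 - w)(D°) = {x - w x : x ∈ D°}`. -/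
theorem meinrenken {V : Type*} [NormedAddCommGroup V] [InnerProductSpace ℝ V]
    [FiniteDimensional ℝ V]
    (W : Subgroup (V ≃ᵢ V)) (D : Set V)
    (hWgen : Subgroup.closure {g : V ≃ᵢ V | g ∈ W ∧ IsAffRefl g} = W)
    (hlf : LocallyFinite fun g : {g : V ≃ᵢ V // g ∈ W ∧ IsAffRefl g} => {x : V | g.1 x = x})
    (hpd : ∀ K : Set V, IsCompact K → {g : V ≃ᵢ V | g ∈ W ∧ ∃ x ∈ K, g x ∈ K}.Finite)
    (hD : ∃ x₀ ∈ (affMirrors W)ᶜ, D = closure (connectedComponentIn (affMirrors W)ᶜ x₀))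
    (hDcpt : IsCompact D)
    (hcover : ∀ v : V, ∃ w ∈ W, ∃ x ∈ D, w x = v)
    (hdisj : ∀ w ∈ W, ∀ w' ∈ W, w ≠ w' →
      ∀ x ∈ interior D, ∀ x' ∈ interior D, w x ≠ w' x') :
    (∀ u : V, ∃ w ∈ W, ∃ x ∈ interior D, u = x - w x) ∧
    (∀ w ∈ W, ∀ w' ∈ W, w ≠ w' →
      Disjoint {u : V | ∃ x ∈ interior D, u = x - w x}
        {u : V | ∃ x ∈ interior D, u = x - w' x}) := by
  obtain ⟨x₀, hx₀, hDeq⟩ := hD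
  set C : Set V := connectedComponentIn (affMirrors W)ᶜ x₀ with hC
  have hMclosed : IsClosed (affMirrors W) := by
    have h1 : affMirrors W = ⋃ g : {g : V ≃ᵢ V // g ∈ W ∧ IsAffRefl g}, {x : V | g.1 x = x} := by
      ext x
      simp [affMirrors]
    rw [h1]
    exact hlf.isClosed_iUnion fun g => isClosed_eq g.1.continuous continuous_id
  have hCopen : IsOpen C := hMclosed.isOpen_compl.connectedComponentIn
  have hCM : ∀ x ∈ C, x ∉ affMirrors W := fun x hx => connectedComponentIn_subset _ _ hx
  have hx₀C : x₀ ∈ C := mem_connectedComponentIn hx₀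
  have hCmax : ∀ S : Set V, IsPreconnected S → (∃ y ∈ S, y ∈ C) → (∀ z ∈ S, z ∉ affMirrors W) →
      S ⊆ C := by
    rintro S hS ⟨y, hyS, hyC⟩ hSM
    have h1 : S ⊆ connectedComponentIn (affMirrors W)ᶜ y :=
      hS.subset_connectedComponentIn hyS hSM
    rwa [← connectedComponentIn_eq hyC] at h1
  have hCD : C ⊆ D := hDeq ▸ subset_closure
  have hint : interior D = C := by
    apply Set.Subset.antisymm
    · apply hCmax
      · exact isPreconnected_connectedComponentIn.subset_closure (interior_maximal hCD hCopen)
          (by rw [← hC, ← hDeq]; exact interior_subset)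
      · exact ⟨x₀, interior_maximal hCD hCopen hx₀C, hx₀C⟩
      · intro z hz hzM
        obtain ⟨r, hr, hrr, hrz⟩ := mk_mem_mirrors.1 hzM
        exact hdisj r hr 1 W.one_mem (mk_refl_ne_one hrr) z hz z hz hrz
    · exact interior_maximal hCD hCopen
  rw [hint] at hdisj ⊢
  have hdisj' : ∀ w ∈ W, ∀ x ∈ C, w x ∈ C → w = 1 := by
    intro w hw x hx hwx
    by_contra hne
    exact hdisj w hw 1 W.one_mem hne x hx (w x) hwx rfl
  have hseg : ∀ y ∈ C, ∀ p, (∀ z ∈ segment ℝ y p, z ∉ affMirrors W) → p ∈ C := by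
    intro y hy p h
    exact hCmax _ (convex_segment y p).isPreconnected ⟨y, left_mem_segment ℝ y p, hy⟩ h
      (right_mem_segment ℝ y p)
  have hstrict : ∀ x ∈ C, ∀ y ∈ C, ∀ g ∈ W, g ≠ 1 → dist x y < dist (g x) y :=
    fun x hx y hy g hg hg1 => mk_strict W C hpd hCM hseg hdisj' hx hy hg hg1
  constructor
  · have hle0 : ∀ p ∈ C, ∀ q ∈ C, ∀ g ∈ W, dist p q ≤ dist p (g q) := by
      intro p hp q hq g hg
      by_cases hg1 : g = 1
      · subst hg1; exact le_rfl
      · have := (hstrict q hq p hp g hg hg1).le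
        rwa [dist_comm q p, dist_comm (g q) p] at this
    have hle : ∀ p ∈ D, ∀ q ∈ D, ∀ g ∈ W, dist p q ≤ dist p (g q) := by
      intro p hp q hq g hg
      have hcl : IsClosed {z : V × V | dist z.1 z.2 ≤ dist z.1 (g z.2)} :=
        isClosed_le (by fun_prop) (continuous_fst.dist (g.continuous.comp continuous_snd))
      have hsub : C ×ˢ C ⊆ {z : V × V | dist z.1 z.2 ≤ dist z.1 (g z.2)} :=
        fun z hz => hle0 z.1 hz.1 z.2 hz.2 g hg
      have h1 := closure_minimal hsub hcl
      rw [closure_prod_eq, ← hDeq] at h1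
      exact h1 (show (p, q) ∈ D ×ˢ D from ⟨hp, hq⟩)
    have hCconv : Convex ℝ C := by
      rw [convex_iff_segment_subset]
      intro x hx y hy
      apply hCmax _ (convex_segment x y).isPreconnected ⟨x, left_mem_segment ℝ x y, hx⟩
      intro z hz hzM
      obtain ⟨r, hr, hrr, hrz⟩ := mk_mem_mirrors.1 hzM
      have h1 := mk_closer hrr hz hrz (fun h => hCM y hy (mk_mem_mirrors.2 ⟨r, hr, hrr, h⟩))
        (fun h => hCM x hx (mk_mem_mirrors.2 ⟨r, hr, hrr, h⟩))
      have h2 := hstrict y hy x hx r hr (mk_refl_ne_one hrr)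
      linarith
    have hDconv : Convex ℝ D := hDeq ▸ hCconv.closure
    apply mk_exist W C D hpd hCM hseg hCD ⟨x₀, hx₀C⟩ _ hle hDcpt hDconv _ hcover
    · intro y hy x hx t ht0 ht1
      have h1 := hCconv.add_smul_sub_mem_interior' (x := x) (y := y) (by rw [← hDeq]; exact hx)
        (by rwa [hCopen.interior_eq]) (t := t) ⟨ht0, ht1⟩
      rwa [hCopen.interior_eq] at h1
    · intro x hx hxM
      have hopen : IsOpen (connectedComponentIn (affMirrors W)ᶜ x) :=
        hMclosed.isOpen_compl.connectedComponentIn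
      have hxx : x ∈ connectedComponentIn (affMirrors W)ᶜ x := mem_connectedComponentIn hxM
      have hxcl : x ∈ closure C := by rw [← hDeq]; exact hx
      obtain ⟨y, hy1, hy2⟩ := mem_closure_iff.1 hxcl _ hopen hxx
      exact hCmax _ isPreconnected_connectedComponentIn ⟨y, hy1, hy2⟩
        (fun z hz => connectedComponentIn_subset _ _ hz) hxx
  · intro w hw w' hw' hne
    rw [Set.disjoint_left]
    rintro u ⟨x, hx, hux⟩ ⟨y, hy, huy⟩
    have h1 : w'⁻¹ * w ≠ 1 := by
      intro h
      exact hne (inv_mul_eq_one.1 h).symm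
    have h2 := hstrict x hx y hy _ (W.mul_mem (W.inv_mem hw') hw) h1
    have h3 : dist ((w'⁻¹ * w) x) y = dist (w x) (w' y) := by
      rw [← w'.dist_eq]
      congr 1
      show w' (w'.symm (w x)) = w x
      rw [IsometryEquiv.apply_symm_apply]
    have h4 : w x - w' y = x - y := by
      have : x - w x = y - w' y := hux.symm.trans huy
      have e : w x - w' y = (x - y) - ((x - w x) - (y - w' y)) := by abel
      rw [e, this]; abel
    rw [h3, dist_eq_norm, dist_eq_norm, h4] at h2
    exact lt_irrefl _ h2
end
end

section
/- For every affine transformation h of V, the sets (h − w)(D) := {h x − w x : x ∈ D} over w ∈ W cover V. If moreover h is 1-Lipschitz (dist(h x₁, h x₂) ≤ dist(x₁, x₂) for all x₁, x₂ ∈ V), then for distinct w, w' ∈ W the sets (h − w)(D°) and (h − w')(D°) are disjoint. -/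
open scoped RealInnerProductSpace

noncomputable section

open MeasureTheory Polynomial in
/-- `t ↦ det (1 + t A)` is a polynomial of degree at most `dim V`. -/
theorem aux_det_poly {V : Type*} [NormedAddCommGroup V] [InnerProductSpace ℝ V]
    [FiniteDimensional ℝ V] (A : V →L[ℝ] V) :
    ∃ p : ℝ[X], p.natDegree ≤ Module.finrank ℝ V ∧
      ∀ t : ℝ, p.eval t = (ContinuousLinearMap.id ℝ V + t • A).det := by
  let b := Module.finBasis ℝ V
  let M := LinearMap.toMatrix b b (A : V →ₗ[ℝ] V)
  refine ⟨Matrix.det ((X : ℝ[X]) • M.map C + (1 : Matrix _ _ ℝ).map C), ?_, ?_⟩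
  · simpa using Polynomial.natDegree_det_X_add_C_le M 1
  · intro t
    rw [← Polynomial.coe_evalRingHom, RingHom.map_det, ContinuousLinearMap.det,
      ← LinearMap.det_toMatrix b]
    congr 1
    have h1 : LinearMap.toMatrix b b
        ((ContinuousLinearMap.id ℝ V + t • A : V →L[ℝ] V) : V →ₗ[ℝ] V) = 1 + t • M := by
      rw [ContinuousLinearMap.toLinearMap_add, ContinuousLinearMap.toLinearMap_smul, map_add, map_smul]
      congr 1
      exact LinearMap.toMatrix_id b
    rw [h1]
    ext i j
    by_cases hij : i = j
    · subst hij; simp; ring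
    · simp [Matrix.one_apply, hij]; ring

open Polynomial in
theorem aux_norm_poly {V : Type*} [NormedAddCommGroup V] [InnerProductSpace ℝ V]
    (x y : V) (k : ℝ) (N : ℕ) :
    ∃ p : ℝ[X], p.natDegree ≤ 2 * N ∧
      ∀ t : ℝ, p.eval t = (k - ‖x + t • y‖ ^ 2) ^ N := by
  refine ⟨(C (-‖y‖ ^ 2) * X ^ 2 + C (-2 * ⟪x, y⟫) * X + C (k - ‖x‖ ^ 2)) ^ N, ?_, ?_⟩
  · refine natDegree_pow_le.trans ?_
    rw [mul_comm]
    gcongr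
    exact natDegree_quadratic_le
  · intro t
    simp only [eval_pow, eval_add, eval_mul, eval_C, eval_X]
    rw [norm_add_sq_real, norm_smul, inner_smul_right, mul_pow, Real.norm_eq_abs, sq_abs]
    ring

open Polynomial in
theorem aux_lagrange (m : ℕ) (τ : ℝ) (hτ : 0 < τ) :
    ∃ (s : Finset ℝ) (c : ℝ → ℝ), (∀ t ∈ s, 0 < t ∧ t < τ) ∧
      ∀ p : ℝ[X], p.natDegree ≤ m → p.eval 1 = ∑ t ∈ s, c t * p.eval t := by
  obtain ⟨s, hs, hc⟩ := (Set.Ioo_infinite hτ).exists_subset_card_eq (m + 1)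
  refine ⟨s, fun t => (Lagrange.basis s id t).eval 1, fun t ht => hs ht, fun p hp => ?_⟩
  have h := Lagrange.eq_interpolate (s := s) (v := (id : ℝ → ℝ)) (f := p)
    (Function.injective_id.injOn) (by
      rw [hc]
      refine (degree_le_natDegree).trans_lt ?_
      exact_mod_cast Nat.lt_succ_of_le hp)
  conv_lhs => rw [h]
  rw [Lagrange.interpolate_apply, eval_finsetSum]
  refine Finset.sum_congr rfl fun t _ => ?_
  simp [mul_comm]

theorem aux_bij {V : Type*} [NormedAddCommGroup V] [InnerProductSpace ℝ V]
    [FiniteDimensional ℝ V] (g : V → V) (K : NNReal) (hg : LipschitzWith K g)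
    (t : ℝ) (ht : 0 < t) (htK : t * K < 1) : Function.Bijective (fun x => x + t • g x) := by
  have hL : ∀ y, ContractingWith (t.toNNReal * K) (fun x => y - t • g x) := by
    intro y
    refine ⟨by rw [← NNReal.coe_lt_coe]; simpa [ht.le] using htK, ?_⟩
    refine LipschitzWith.of_dist_le_mul fun a b => ?_
    rw [dist_sub_left, dist_smul₀, Real.norm_of_nonneg ht.le]
    have := hg.dist_le_mul a b
    simp only [NNReal.coe_mul, Real.coe_toNNReal t ht.le]
    rw [mul_assoc]
    gcongr
  constructor
  · intro a b hab
    have hab : a + t • g a = b + t • g b := hab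
    refine (hL (a + t • g a)).fixedPoint_unique' ?_ ?_
    · simp [Function.IsFixedPt]
    · rw [hab]; simp [Function.IsFixedPt]
  · intro y
    refine ⟨ContractingWith.fixedPoint _ (hL y), ?_⟩
    have := (hL y).fixedPoint_isFixedPt
    rw [Function.IsFixedPt, sub_eq_iff_eq_add] at this
    exact this.symm
open MeasureTheory in
/-- change of variables for small `t` -/
theorem aux_cov {V : Type*} [NormedAddCommGroup V] [InnerProductSpace ℝ V]
    [FiniteDimensional ℝ V] [MeasurableSpace V] [BorelSpace V]
    (g : V → V) (K : NNReal) (hg : LipschitzWith K g)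
    (R : ℝ) (hR : ∀ x, R < ‖x‖ → g x = 0) :
    ∃ τ : ℝ, 0 < τ ∧ ∀ t, 0 < t → t < τ → ∀ φ : V → ℝ,
      ∫ x in Metric.closedBall 0 R ∩ {x | DifferentiableAt ℝ g x},
        (ContinuousLinearMap.id ℝ V + t • fderiv ℝ g x).det * φ (x + t • g x)
          ∂(Measure.hausdorffMeasure (Module.finrank ℝ V)) =
      ∫ x in Metric.closedBall 0 R, φ x ∂(Measure.hausdorffMeasure (Module.finrank ℝ V)) := by
  obtain ⟨δ, hδ, hdet⟩ : ∃ δ > 0, ∀ B : V →L[ℝ] V, ‖B‖ < δ →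
      0 < (ContinuousLinearMap.id ℝ V + B).det := by
    have hc : Continuous fun B : V →L[ℝ] V => (ContinuousLinearMap.id ℝ V + B).det :=
      ContinuousLinearMap.continuous_det.comp (by fun_prop)
    have h0 : 0 < (ContinuousLinearMap.id ℝ V + 0).det := by
      simp [ContinuousLinearMap.det]
    obtain ⟨δ, hδ, h⟩ := Metric.eventually_nhds_iff.1 (hc.continuousAt.eventually_const_lt h0)
    exact ⟨δ, hδ, fun B hB => h (by simpa using hB)⟩
  refine ⟨min 1 δ / (K + 1), by positivity, fun t ht htτ φ => ?_⟩
  have hK : (0 : ℝ) ≤ K := K.2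
  rw [lt_div_iff₀ (by positivity)] at htτ
  have h1 : t * K < 1 := by
    have := htτ.trans_le (min_le_left _ _)
    nlinarith
  have h2 : t * K < δ := by
    have := htτ.trans_le (min_le_right _ _)
    nlinarith
  have hbij := aux_bij g K hg t ht h1
  set μ : Measure V := Measure.hausdorffMeasure (Module.finrank ℝ V) with hμ
  set S := {x | DifferentiableAt ℝ g x} with hS
  set B := Metric.closedBall (0 : V) R with hB
  have hSm : MeasurableSet S := measurableSet_of_differentiableAt ℝ g
  have hSn : μ Sᶜ = 0 := hg.ae_differentiableAt (μ := μ)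
  set F : V → V := fun x => x + t • g x with hF
  have hFL : LipschitzWith (1 + t.toNNReal * K) F := by
    refine LipschitzWith.of_dist_le_mul fun a b => ?_
    have := hg.dist_le_mul a b
    refine (dist_add_add_le _ _ _ _).trans ?_
    rw [dist_smul₀, Real.norm_of_nonneg ht.le]
    simp only [NNReal.coe_add, NNReal.coe_one, NNReal.coe_mul, Real.coe_toNNReal t ht.le]
    nlinarith
  have hFB : F '' B = B := by
    have hc : F '' Bᶜ = Bᶜ := by
      have : ∀ x ∈ Bᶜ, F x = x := by
        intro x hx
        have : R < ‖x‖ := by simpa [hB] using hx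
        simp [hF, hR x this]
      rw [Set.image_congr this, Set.image_id']
    rw [Set.image_compl_eq hbij] at hc
    exact compl_injective hc
  have hae : (F '' (B ∩ S) : Set V) =ᵐ[μ] B := by
    refine Filter.EventuallyLE.antisymm ?_ ?_
    · refine LE.le.eventuallyLE ?_
      conv_rhs => rw [← hFB]
      exact Set.image_mono Set.inter_subset_left
    · rw [ae_le_set]
      refine measure_mono_null (t := F '' Sᶜ) ?_ ?_
      · rintro y ⟨hy, hy'⟩
        rw [← hFB] at hy
        obtain ⟨x, hx, rfl⟩ := hy
        exact ⟨x, fun hxS => hy' ⟨x, ⟨hx, hxS⟩, rfl⟩, rfl⟩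
      · have := hFL.hausdorffMeasure_image_le (d := Module.finrank ℝ V) (by positivity) Sᶜ
        rw [← hμ, hSn, mul_zero] at this
        exact le_antisymm this bot_le
  rw [← setIntegral_congr_set hae, integral_image_eq_integral_abs_det_fderiv_smul μ
    (f' := fun x => ContinuousLinearMap.id ℝ V + t • fderiv ℝ g x)
    (Metric.isClosed_closedBall.measurableSet.inter hSm) ?_ hbij.1.injOn]
  · refine setIntegral_congr_fun (Metric.isClosed_closedBall.measurableSet.inter hSm) ?_
    intro x hx
    simp only [smul_eq_mul]
    rw [abs_of_pos]
    apply hdet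
    rw [norm_smul, Real.norm_of_nonneg ht.le]
    refine lt_of_le_of_lt ?_ h2
    gcongr
    exact norm_fderiv_le_of_lipschitz ℝ hg
  · intro x hx
    have : DifferentiableAt ℝ g x := hx.2
    exact ((hasFDerivAt_id x).add (this.hasFDerivAt.const_smul t)).hasFDerivWithinAt

open MeasureTheory in
/-- Brouwer type statement: a compactly supported Lipschitz perturbation of the identity hits 0. -/
theorem aux_hit {V : Type*} [NormedAddCommGroup V] [InnerProductSpace ℝ V]
    [FiniteDimensional ℝ V]
    (g : V → V) (K : NNReal) (hg : LipschitzWith K g)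
    (R : ℝ) (hR0 : 0 < R) (hR : ∀ x, R < ‖x‖ → g x = 0) : ∃ x, x + g x = 0 := by
  let _ : MeasurableSpace V := borel V
  have : BorelSpace V := ⟨rfl⟩
  by_contra! hne
  have hBc : IsCompact (Metric.closedBall (0 : V) R) := isCompact_closedBall 0 R
  have hgc := hg.continuous
  have hcont : Continuous fun x => ‖x + g x‖ := by fun_prop
  obtain ⟨x₀, hx₀, hmin⟩ := hBc.exists_isMinOn ⟨0, by simp [hR0.le]⟩ hcont.continuousOn
  obtain ⟨x₁, hx₁, hmax⟩ := hBc.exists_isMaxOn ⟨0, by simp [hR0.le]⟩ hcont.continuousOn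
  set ε := ‖x₀ + g x₀‖ with hε
  have hε0 : 0 < ε := norm_pos_iff.2 (hne x₀)
  set k : ℝ := max R ‖x₁ + g x₁‖ with hk
  have hkR : R ≤ k := le_max_left _ _
  set μ : Measure V := Measure.hausdorffMeasure (Module.finrank ℝ V) with hμ
  set S := {x | DifferentiableAt ℝ g x} with hS
  set B := Metric.closedBall (0 : V) R with hB
  have hSm : MeasurableSet S := measurableSet_of_differentiableAt ℝ g
  have hBm : MeasurableSet B := Metric.isClosed_closedBall.measurableSet
  have hBfin : μ B < ⊤ := hBc.measure_lt_top
  have hBSfin : μ (B ∩ S) < ⊤ := (measure_mono Set.inter_subset_left).trans_lt hBfin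
  obtain ⟨τ, hτ, hcov⟩ := aux_cov g K hg R hR
  -- bound of the determinants
  have hdb : ∀ t : ℝ, ∃ Cd : ℝ, 0 ≤ Cd ∧ ∀ x,
      |(ContinuousLinearMap.id ℝ V + t • fderiv ℝ g x).det| ≤ Cd := by
    intro t
    have hc : Continuous fun A : V →L[ℝ] V => (ContinuousLinearMap.id ℝ V + t • A).det :=
      ContinuousLinearMap.continuous_det.comp (by fun_prop)
    obtain ⟨Cd, h⟩ := (isCompact_closedBall (0 : V →L[ℝ] V) K).exists_bound_of_continuousOn
      hc.continuousOn
    refine ⟨|Cd|, abs_nonneg _, fun x => (h _ ?_).trans (le_abs_self _)⟩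
    simpa using norm_fderiv_le_of_lipschitz ℝ hg
  have hint : ∀ (N : ℕ) (t : ℝ), IntegrableOn (fun x =>
      (ContinuousLinearMap.id ℝ V + t • fderiv ℝ g x).det * (k ^ 2 - ‖x + t • g x‖ ^ 2) ^ N)
      (B ∩ S) μ := by
    intro N t
    obtain ⟨Cd, hCd0, hCd⟩ := hdb t
    have hc : Continuous fun x => (k ^ 2 - ‖x + t • g x‖ ^ 2) ^ N := by fun_prop
    obtain ⟨Cf, hCf⟩ := hBc.exists_bound_of_continuousOn hc.continuousOn
    have hm : Measurable fun x => (ContinuousLinearMap.id ℝ V + t • fderiv ℝ g x).det := by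
      have hc : Continuous fun A : V →L[ℝ] V => (ContinuousLinearMap.id ℝ V + t • A).det :=
        ContinuousLinearMap.continuous_det.comp (by fun_prop)
      exact hc.measurable.comp (measurable_fderiv ℝ g)
    refine IntegrableOn.of_bound hBSfin (hm.mul hc.measurable).aestronglyMeasurable (Cd * Cf) ?_
    refine (ae_restrict_iff' (hBm.inter hSm)).2 (Filter.Eventually.of_forall fun x hx => ?_)
    rw [norm_mul]
    exact mul_le_mul (hCd x) (hCf x hx.1) (norm_nonneg _) hCd0
  -- the identity at `t = 1`
  have key : ∀ N : ℕ, ∫ x in B ∩ S, (ContinuousLinearMap.id ℝ V + (1 : ℝ) • fderiv ℝ g x).det *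
      (k ^ 2 - ‖x + (1 : ℝ) • g x‖ ^ 2) ^ N ∂μ = ∫ x in B, (k ^ 2 - ‖x‖ ^ 2) ^ N ∂μ := by
    intro N
    obtain ⟨s, c, hs, hc⟩ := aux_lagrange (Module.finrank ℝ V + 2 * N) τ hτ
    have hsum : ∑ t ∈ s, c t = 1 := by
      have := hc 1 (by simp)
      simpa using this.symm
    have hpt : ∀ x, (ContinuousLinearMap.id ℝ V + (1 : ℝ) • fderiv ℝ g x).det *
        (k ^ 2 - ‖x + (1 : ℝ) • g x‖ ^ 2) ^ N = ∑ t ∈ s, c t *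
        ((ContinuousLinearMap.id ℝ V + t • fderiv ℝ g x).det *
        (k ^ 2 - ‖x + t • g x‖ ^ 2) ^ N) := by
      intro x
      obtain ⟨p, hp, hp'⟩ := aux_det_poly (fderiv ℝ g x)
      obtain ⟨q, hq, hq'⟩ := aux_norm_poly x (g x) (k ^ 2) N
      have := hc (p * q) (Polynomial.natDegree_mul_le.trans (add_le_add hp hq))
      simpa only [Polynomial.eval_mul, hp', hq'] using this
    simp_rw [hpt]
    rw [integral_finsetSum _ fun t _ => (hint N t).const_mul (c t)]
    simp_rw [integral_const_mul]
    rw [Finset.sum_congr rfl fun t ht => by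
      rw [hcov t (hs t ht).1 (hs t ht).2 (fun y => (k ^ 2 - ‖y‖ ^ 2) ^ N)], ← Finset.sum_mul,
      hsum, one_mul]
  obtain ⟨Cd, hCd0, hCd⟩ := hdb 1
  set ρ : ℝ := min (ε / 2) R with hρ
  have hρ0 : 0 < ρ := lt_min (by positivity) hR0
  have hεk : ε ≤ k := (hmin hx₁ : ε ≤ _).trans (le_max_right _ _)
  set q := k ^ 2 - ε ^ 2 with hq
  set q' := k ^ 2 - ρ ^ 2 with hq'
  have hqq : q < q' := by
    have : ρ ≤ ε / 2 := min_le_left _ _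
    simp only [hq, hq']; nlinarith
  have hq0 : 0 ≤ q := by simp only [hq]; nlinarith
  have hq'0 : 0 < q' := hq0.trans_lt hqq
  have hup : ∀ N : ℕ, ∫ x in B, (k ^ 2 - ‖x‖ ^ 2) ^ N ∂μ ≤ Cd * q ^ N * μ.real (B ∩ S) := by
    intro N
    rw [← key N]
    refine (Real.le_norm_self _).trans
      (norm_setIntegral_le_of_norm_le_const hBSfin fun x hx => ?_)
    rw [norm_mul]
    refine mul_le_mul (hCd x) ?_ (norm_nonneg _) hCd0
    rw [one_smul, norm_pow]
    have h1 : ε ≤ ‖x + g x‖ := hmin hx.1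
    have h2 : ‖x + g x‖ ≤ k := (hmax hx.1 : _ ≤ ‖x₁ + g x₁‖).trans (le_max_right _ _)
    gcongr
    rw [Real.norm_of_nonneg (by nlinarith)]
    simp only [hq]; nlinarith
  have hlow : ∀ N : ℕ, q' ^ N * μ.real (Metric.closedBall 0 ρ) ≤
      ∫ x in B, (k ^ 2 - ‖x‖ ^ 2) ^ N ∂μ := by
    intro N
    have hc : Continuous fun x : V => (k ^ 2 - ‖x‖ ^ 2) ^ N := by fun_prop
    have hsub : Metric.closedBall (0 : V) ρ ⊆ B :=
      Metric.closedBall_subset_closedBall (min_le_right _ _)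
    have hi : IntegrableOn (fun x : V => (k ^ 2 - ‖x‖ ^ 2) ^ N) B μ :=
      hc.continuousOn.integrableOn_compact hBc
    calc q' ^ N * μ.real (Metric.closedBall 0 ρ)
        = ∫ x in Metric.closedBall (0 : V) ρ, q' ^ N ∂μ := by
          rw [setIntegral_const, smul_eq_mul, mul_comm]
      _ ≤ ∫ x in Metric.closedBall (0 : V) ρ, (k ^ 2 - ‖x‖ ^ 2) ^ N ∂μ := by
          refine setIntegral_mono_on ?_ (hi.mono_set hsub)
            Metric.isClosed_closedBall.measurableSet fun x hx => ?_
          · exact continuousOn_const.integrableOn_compact (isCompact_closedBall _ _)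
          · have : ‖x‖ ≤ ρ := by simpa using hx
            simp only [hq'] at hq'0 ⊢
            gcongr
      _ ≤ _ := by
          refine setIntegral_mono_set hi ?_ (LE.le.eventuallyLE hsub)
          refine (ae_restrict_iff' hBm).2 (Filter.Eventually.of_forall fun x hx => ?_)
          have : ‖x‖ ≤ R := by simpa [hB] using hx
          have : 0 ≤ k ^ 2 - ‖x‖ ^ 2 := by nlinarith [norm_nonneg x]
          exact pow_nonneg this N
  have hpos : 0 < μ.real (Metric.closedBall (0 : V) ρ) :=
    ENNReal.toReal_pos (Metric.measure_closedBall_pos μ 0 hρ0).ne'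
      (isCompact_closedBall _ _).measure_lt_top.ne
  have hlim : Filter.Tendsto (fun N : ℕ => Cd * μ.real (B ∩ S) * (q / q') ^ N) Filter.atTop
      (nhds (Cd * μ.real (B ∩ S) * 0)) :=
    (tendsto_pow_atTop_nhds_zero_of_lt_one (by positivity) ((div_lt_one hq'0).2 hqq)).const_mul _
  rw [mul_zero] at hlim
  obtain ⟨N, hN⟩ := (hlim.eventually_lt_const hpos).exists
  have h := (hlow N).trans (hup N)
  rw [div_pow, mul_div_assoc', div_lt_iff₀ (by positivity)] at hN
  nlinarith

theorem aux_fixed {V : Type*} [NormedAddCommGroup V] [InnerProductSpace ℝ V]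
    [FiniteDimensional ℝ V]
    (f : V → V) (K : NNReal) (hf : LipschitzWith K f)
    (M : ℝ) (hM0 : 0 ≤ M) (hM : ∀ x, ‖f x‖ ≤ M) : ∃ x, f x = x := by
  set χ : V → ℝ := fun x => max 0 (min 1 (M + 1 - ‖x‖)) with hχ
  have hχ0 : ∀ x, 0 ≤ χ x := fun x => le_max_left _ _
  have hχ1 : ∀ x, χ x ≤ 1 := fun x => max_le zero_le_one (min_le_left _ _)
  have hχL : ∀ x y, |χ x - χ y| ≤ ‖x - y‖ := by
    intro x y
    refine (abs_max_sub_max_le_max _ _ _ _).trans ?_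
    refine max_le (by simp) ?_
    refine (abs_min_sub_min_le_max _ _ _ _).trans (max_le (by simp) ?_)
    have := abs_norm_sub_norm_le x y
    rw [abs_sub_comm] at this
    rwa [sub_sub_sub_cancel_left]
  obtain ⟨x, hx⟩ := aux_hit (fun x => -(χ x • f x)) (K + ⟨M, hM0⟩) (by
    refine LipschitzWith.of_dist_le_mul fun x y => ?_
    rw [dist_neg_neg, dist_eq_norm, dist_eq_norm]
    have h1 := hf.dist_le_mul x y
    rw [dist_eq_norm, dist_eq_norm] at h1
    have h2 : χ x • f x - χ y • f y = χ x • (f x - f y) + (χ x - χ y) • f y := by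
      module
    rw [h2]
    refine (norm_add_le _ _).trans ?_
    rw [norm_smul, norm_smul, Real.norm_of_nonneg (hχ0 x), Real.norm_eq_abs]
    have h3 : χ x * ‖f x - f y‖ ≤ 1 * (K * ‖x - y‖) :=
      mul_le_mul (hχ1 x) h1 (norm_nonneg _) zero_le_one
    have h4 : |χ x - χ y| * ‖f y‖ ≤ ‖x - y‖ * M :=
      mul_le_mul (hχL x y) (hM y) (norm_nonneg _) (norm_nonneg _)
    have h5 : ((K + ⟨M, hM0⟩ : NNReal) : ℝ) = K + M := rfl
    rw [h5]
    linarith) (M + 1) (by positivity) (by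
    intro x hx
    have : χ x = 0 := max_eq_left ((min_le_right _ _).trans (by linarith))
    simp [this])
  have hx' : x = χ x • f x := by
    rwa [add_neg_eq_zero] at hx
  have hn : ‖x‖ ≤ M := by
    rw [hx', norm_smul, Real.norm_of_nonneg (hχ0 x)]
    nlinarith [hχ1 x, hχ0 x, hM x, norm_nonneg (f x)]
  have : χ x = 1 := by
    simp only [hχ]
    rw [min_eq_left (by linarith), max_eq_right zero_le_one]
  rw [this, one_smul] at hx'
  exact ⟨x, hx'.symm⟩

theorem aux_refl_dist {V : Type*} [NormedAddCommGroup V] [InnerProductSpace ℝ V]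
    (u : V) (c : ℝ) (hu : u ≠ 0) (x z : V)
    (h : (⟪x, u⟫ - c) * (⟪z, u⟫ - c) < 0) :
    dist x (z - ((2 * (⟪z, u⟫ - c)) / ⟪u, u⟫) • u) < dist x z := by
  have hu2 : 0 < ‖u‖ ^ 2 := by positivity
  rw [dist_eq_norm, dist_eq_norm]
  refine lt_of_pow_lt_pow_left₀ 2 (norm_nonneg _) ?_
  rw [real_inner_self_eq_norm_sq]
  set r := (2 * (⟪z, u⟫ - c)) / ‖u‖ ^ 2 with hr
  have h1 : x - (z - r • u) = (x - z) + r • u := by abel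
  rw [h1, norm_add_sq_real, norm_smul, inner_smul_right, mul_pow, Real.norm_eq_abs, sq_abs,
    inner_sub_left]
  have h2 : r * ‖u‖ ^ 2 = 2 * (⟪z, u⟫ - c) := by rw [hr]; field_simp
  have h3 : r ^ 2 * ‖u‖ ^ 2 = r * (2 * (⟪z, u⟫ - c)) := by rw [← h2]; ring
  rw [h3]
  have h4 : r * (⟪x, u⟫ - c) < 0 := by
    rw [hr, div_mul_eq_mul_div]
    exact div_neg_of_neg_of_pos (by linarith) hu2
  linarith

/-- a reflection is not the identity -/
theorem aux_refl_ne {V : Type*} [NormedAddCommGroup V] [InnerProductSpace ℝ V]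
    (g : V ≃ᵢ V) (hg : IsAffRefl g) : g ≠ 1 := by
  rintro rfl
  obtain ⟨u, c, hu, h⟩ := hg
  have hu2 : ⟪u, u⟫ ≠ 0 := inner_self_ne_zero.2 hu
  have := h (((c + 1) / ⟪u, u⟫) • u)
  rw [inner_smul_left] at this
  simp only [IsometryEquiv.coe_one, id, conj_trivial, div_mul_cancel₀ _ hu2] at this
  rw [eq_comm, sub_eq_self, smul_eq_zero] at this
  rcases this with h1 | h1
  · rw [div_eq_zero_iff] at h1
    rcases h1 with h1 | h1
    · norm_num at h1
    · exact hu2 h1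
  · exact hu h1

/-- Points of the open chamber: strict inequality. -/
theorem aux_strict {V : Type*} [NormedAddCommGroup V] [InnerProductSpace ℝ V]
    [FiniteDimensional ℝ V]
    (W : Subgroup (V ≃ᵢ V)) (D : Set V)
    (hlf : LocallyFinite fun g : {g : V ≃ᵢ V // g ∈ W ∧ IsAffRefl g} => {x : V | g.1 x = x})
    (hpd : ∀ K : Set V, IsCompact K → {g : V ≃ᵢ V | g ∈ W ∧ ∃ x ∈ K, g x ∈ K}.Finite)
    (hD : ∃ x₀ ∈ (affMirrors W)ᶜ, D = closure (connectedComponentIn (affMirrors W)ᶜ x₀))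
    (hdisj : ∀ w ∈ W, ∀ w' ∈ W, w ≠ w' →
      ∀ x ∈ interior D, ∀ x' ∈ interior D, w x ≠ w' x') :
    D = closure (interior D) ∧ 
    ∀ x ∈ interior D, ∀ y ∈ interior D, ∀ w ∈ W, w ≠ 1 → dist x y < dist x (w y) := by
  obtain ⟨x₀, hx₀, hDeq⟩ := hD
  have hopen : IsOpen (affMirrors W)ᶜ := by
    rw [isOpen_compl_iff]
    have : affMirrors W =
        ⋃ g : {g : V ≃ᵢ V // g ∈ W ∧ IsAffRefl g}, {x : V | g.1 x = x} := by
      ext x; simp [affMirrors]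
    rw [this]
    exact hlf.isClosed_iUnion fun g => isClosed_eq g.1.continuous continuous_id
  have hCint : connectedComponentIn (affMirrors W)ᶜ x₀ ⊆ interior D := by
    refine interior_maximal ?_ hopen.connectedComponentIn
    rw [hDeq]; exact subset_closure
  refine ⟨?_, ?_⟩
  · refine subset_antisymm ?_ ?_
    · conv_lhs => rw [hDeq]
      exact closure_mono hCint
    · refine closure_minimal interior_subset ?_
      rw [hDeq]; exact isClosed_closure
  intro x hx y hy w hw hw1
  by_contra! hle
  -- minimiser over the finite set of `v ∈ W`, `v ≠ 1`, with `dist x (v y) ≤ dist x y`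
  have hfin : {v : V ≃ᵢ V | v ∈ W ∧ v ≠ 1 ∧ dist x (v y) ≤ dist x y}.Finite := by
    refine (hpd _ (isCompact_closedBall x (dist x y))).subset ?_
    rintro v ⟨hv, -, hvd⟩
    exact ⟨hv, y, by simp [dist_comm], by simpa [dist_comm] using hvd⟩
  obtain ⟨v, ⟨hv, hv1, hvd⟩, hmin⟩ := hfin.exists_minimalFor (fun v => dist x (v y)) _
    ⟨w, hw, hw1, hle⟩
  have hmin' : ∀ v' ∈ W, dist x (v y) ≤ dist x (v' y) := by
    intro v' hv'
    by_contra! hlt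
    by_cases h1 : v' = 1
    · subst h1
      simp only [IsometryEquiv.coe_one, id] at hlt
      exact absurd hvd (not_le.2 hlt)
    · have := hmin ⟨hv', h1, (hlt.le.trans hvd)⟩ hlt.le
      exact absurd this (not_le.2 hlt)
  set z := v y with hz
  have hseg : segment ℝ x z ⊆ (affMirrors W)ᶜ := by
    rintro p ⟨a, b, ha, hb, hab, rfl⟩ hp
    simp only [affMirrors, Set.mem_iUnion, Set.mem_ofPred_eq] at hp
    obtain ⟨g, ⟨hgW, hgr⟩, hgp⟩ := hp
    have hg1 := aux_refl_ne g hgr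
    have hgx : g x ≠ x := hdisj g hgW 1 W.one_mem hg1 x hx x hx
    have hgz : g z ≠ z := by
      have := hdisj (g * v) (W.mul_mem hgW hv) v hv (by simpa using hg1) y hy y hy
      simpa using this
    have hd := hmin' (g * v) (W.mul_mem hgW hv)
    rw [IsometryEquiv.mul_apply, ← hz] at hd
    obtain ⟨u, c, hu, h⟩ := hgr
    have hfix : ∀ q, ⟪q, u⟫ - c = 0 → g q = q := by
      intro q hq
      rw [h, hq]; simp
    have hx0 : ⟪x, u⟫ - c ≠ 0 := fun h0 => hgx (hfix x h0)
    have hz0 : ⟪z, u⟫ - c ≠ 0 := fun h0 => hgz (hfix z h0)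
    have hxz : 0 ≤ (⟪x, u⟫ - c) * (⟪z, u⟫ - c) := by
      by_contra! hneg
      have := aux_refl_dist u c hu x z hneg
      rw [← h] at this
      exact absurd hd (not_le.2 this)
    have hxz' : 0 < (⟪x, u⟫ - c) * (⟪z, u⟫ - c) :=
      lt_of_le_of_ne hxz (mul_ne_zero hx0 hz0).symm
    have hu2 : ⟪u, u⟫ ≠ 0 := inner_self_ne_zero.2 hu
    have hp0 : ⟪a • x + b • z, u⟫ - c = 0 := by
      rw [h, sub_eq_self, smul_eq_zero, div_eq_zero_iff] at hgp
      rcases hgp with (h1 | h1) | h1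
      · linarith
      · exact absurd h1 hu2
      · exact absurd h1 hu
    rw [inner_add_left, inner_smul_left, inner_smul_left] at hp0
    simp only [conj_trivial] at hp0
    have hp1 : a * (⟪x, u⟫ - c) + b * (⟪z, u⟫ - c) = 0 := by
      have : c = (a + b) * c := by rw [hab, one_mul]
      linarith
    have hsq : 0 < (⟪x, u⟫ - c) ^ 2 := by positivity
    have hmul : a * (⟪x, u⟫ - c) ^ 2 + b * ((⟪x, u⟫ - c) * (⟪z, u⟫ - c)) = 0 := by
      linear_combination (⟪x, u⟫ - c) * hp1
    rcases ha.eq_or_lt with ha0 | ha0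
    · have : b = 1 := by linarith
      subst this
      rw [← ha0] at hmul
      linarith
    · have := mul_pos ha0 hsq
      have := mul_nonneg hb hxz
      linarith
  have hxM : x ∈ (affMirrors W)ᶜ := hseg (left_mem_segment ℝ x z)
  have hCx : connectedComponentIn (affMirrors W)ᶜ x₀ = connectedComponentIn (affMirrors W)ᶜ x := by
    have hxD : x ∈ closure (connectedComponentIn (affMirrors W)ᶜ x₀) := by
      rw [← hDeq]; exact interior_subset hx
    obtain ⟨p, hp1, hp2⟩ := mem_closure_iff.1 hxD _ hopen.connectedComponentIn
      (mem_connectedComponentIn hxM)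
    rw [connectedComponentIn_eq hp1, connectedComponentIn_eq hp2]
  have hzC : z ∈ connectedComponentIn (affMirrors W)ᶜ x :=
    (convex_segment x z).isPreconnected.subset_connectedComponentIn
      (left_mem_segment ℝ x z) hseg (right_mem_segment ℝ x z)
  have hzD : z ∈ interior D := hCint (hCx ▸ hzC)
  exact hdisj v hv 1 W.one_mem hv1 y hy z hzD rfl

/-- For every affine transformation `h` of `V` the sets `(h - w)(D)`, `w ∈ W`, cover
`V`; if moreover `h` is 1-Lipschitz, the sets `(h - w)(D°)` are pairwise disjoint. -/
theorem cover_sub_affine {V : Type*} [NormedAddCommGroup V] [InnerProductSpace ℝ V]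
    [FiniteDimensional ℝ V]
    (W : Subgroup (V ≃ᵢ V)) (D : Set V)
    (hWgen : Subgroup.closure {g : V ≃ᵢ V | g ∈ W ∧ IsAffRefl g} = W)
    (hlf : LocallyFinite fun g : {g : V ≃ᵢ V // g ∈ W ∧ IsAffRefl g} => {x : V | g.1 x = x})
    (hpd : ∀ K : Set V, IsCompact K → {g : V ≃ᵢ V | g ∈ W ∧ ∃ x ∈ K, g x ∈ K}.Finite)
    (hD : ∃ x₀ ∈ (affMirrors W)ᶜ, D = closure (connectedComponentIn (affMirrors W)ᶜ x₀))
    (hDcpt : IsCompact D)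
    (hcover : ∀ v : V, ∃ w ∈ W, ∃ x ∈ D, w x = v)
    (hdisj : ∀ w ∈ W, ∀ w' ∈ W, w ≠ w' →
      ∀ x ∈ interior D, ∀ x' ∈ interior D, w x ≠ w' x')
    (h : V ≃ᵃ[ℝ] V) :
    (∀ u : V, ∃ w ∈ W, ∃ x ∈ D, u = h x - w x) ∧
    ((∀ x₁ x₂ : V, dist (h x₁) (h x₂) ≤ dist x₁ x₂) →
      ∀ w ∈ W, ∀ w' ∈ W, w ≠ w' →
        Disjoint {u : V | ∃ x ∈ interior D, u = h x - w x}
          {u : V | ∃ x ∈ interior D, u = h x - w' x}) := by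
  obtain ⟨hDcl, hstrict⟩ := aux_strict W D hlf hpd hD hdisj
  constructor
  · intro u
    have hle : ∀ w ∈ W, ∀ x ∈ D, ∀ y ∈ D, dist x y ≤ dist x (w y) := by
      intro w hw
      have h1 : ∀ x ∈ interior D, ∀ y ∈ interior D, dist x y ≤ dist x (w y) := by
        intro x hx y hy
        by_cases hw1 : w = 1
        · subst hw1; simp
        · exact (hstrict x hx y hy w hw hw1).le
      have hwc := w.continuous
      intro x hx y hy
      have hcl : IsClosed {p : V × V | dist p.1 p.2 ≤ dist p.1 (w p.2)} :=
        isClosed_le (by fun_prop) (by fun_prop)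
      have hsub : interior D ×ˢ interior D ⊆ {p : V × V | dist p.1 p.2 ≤ dist p.1 (w p.2)} :=
        fun p hp => h1 p.1 hp.1 p.2 hp.2
      have hmem : (x, y) ∈ closure (interior D ×ˢ interior D) := by
        rw [closure_prod_eq, ← hDcl]
        exact ⟨hx, hy⟩
      exact closure_minimal hsub hcl hmem
    choose ω hω fold hfold hfe using hcover
    have hfL : LipschitzWith 1 fold := by
      refine LipschitzWith.of_dist_le_mul fun a b => ?_
      rw [NNReal.coe_one, one_mul]
      have h1 := hle ((ω a)⁻¹ * ω b) (W.mul_mem (W.inv_mem (hω a)) (hω b)) _ (hfold a) _ (hfold b)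
      rw [← (ω a).dist_eq (fold a) (((ω a)⁻¹ * ω b) (fold b)),
        ← IsometryEquiv.mul_apply, mul_inv_cancel_left, hfe, hfe] at h1
      exact h1
    obtain ⟨M, hM⟩ := hDcpt.isBounded.exists_norm_le
    let L : V →L[ℝ] V := LinearMap.toContinuousLinearMap (h.linear : V →ₗ[ℝ] V)
    have hhL : LipschitzWith ‖L‖₊ (fun x => h x - u) := by
      refine LipschitzWith.of_dist_le_mul fun a b => ?_
      have h1 : h a - h b = L (a - b) := by
        have := h.toAffineMap.linearMap_vsub a b
        simpa [L] using this.symm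
      rw [dist_sub_right, dist_eq_norm, h1, dist_eq_norm]
      exact L.le_opNorm _
    have hM' : ∀ x, ‖fold (h x - u)‖ ≤ |M| := fun x => (hM _ (hfold _)).trans (le_abs_self M)
    obtain ⟨x, hx⟩ := aux_fixed (fun x => fold (h x - u)) _ (hfL.comp hhL) |M| (abs_nonneg M) hM'
    have hx' : fold (h x - u) = x := hx
    refine ⟨ω (h x - u), hω _, x, ?_, ?_⟩
    · rw [← hx']; exact hfold _
    · have := hfe (h x - u)
      rw [hx'] at this
      rw [this]; abel
  · intro hlip w hw w' hw' hne
    rw [Set.disjoint_left]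
    rintro u ⟨x, hx, hux⟩ ⟨y, hy, huy⟩
    have h1 := hstrict x hx y hy (w⁻¹ * w') (W.mul_mem (W.inv_mem hw) hw')
      (fun h0 => hne (inv_mul_eq_one.1 h0))
    rw [← w.dist_eq x ((w⁻¹ * w') y), ← IsometryEquiv.mul_apply, mul_inv_cancel_left] at h1
    have h2 : h x - h y = w x - w' y := by
      have h3 : h x - w x = h y - w' y := hux.symm.trans huy
      rw [sub_eq_sub_iff_add_eq_add] at h3 ⊢
      rw [h3]; abel
    have h4 := hlip x y
    rw [dist_eq_norm (h x), h2, ← dist_eq_norm] at h4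
    exact absurd h1 (not_lt.2 h4)
end
end
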